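/- Let g : [1,∞) → (0,∞) be a bounded function that is regularly varying of exponent α ∈ (0,1), i.e. for each λ > 0, g(λt)/g(t) → λ^{-α} as t → ∞. Define g̃(t) := ∫₀^{⌊t⌋} g(s) ds. Then g̃ is regularly varying of exponent -(1-α), i.e. for each λ > 0, g̃(λt)/g̃(t) → λ^{1-α} as t → ∞. -/

import Mathlib

open Filter MeasureTheory

lemma aux_ii (g : ℝ → ℝ) (hmeas : Measurable g)
    (hpos : ∀ t : ℝ, 0 ≤ t → 0 < g t) (M : ℝ) (hM : ∀ t : ℝ, g t ≤ M)
    (a b : ℝ) (ha : 0 ≤ a) (hb : 0 ≤ b) : IntervalIntegrable g volume a b := by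
  rw [intervalIntegrable_iff]
  refine Measure.integrableOn_of_bounded (M := M) (by simp) hmeas.aestronglyMeasurable ?_
  refine (ae_restrict_iff' measurableSet_uIoc).2 (Eventually.of_forall fun x hx => ?_)
  have h0 : 0 ≤ x := le_trans (le_min ha hb) hx.1.le
  rw [Real.norm_eq_abs, abs_of_pos (hpos x h0)]
  exact hM x

lemma aux_top (g : ℝ → ℝ) (α : ℝ) (hα : α ∈ Set.Ioo (0:ℝ) 1)
    (hpos : ∀ t : ℝ, 0 ≤ t → 0 < g t)
    (hii : ∀ a b : ℝ, 0 ≤ a → 0 ≤ b → IntervalIntegrable g volume a b)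
    (hreg : ∀ l : ℝ, 0 < l →
      Tendsto (fun t : ℝ => g (l * t) / g t) atTop (nhds (l ^ (-α)))) :
    Tendsto (fun t : ℝ => ∫ s in (0:ℝ)..t, g s) atTop atTop := by
  have hc : (1:ℝ)/2 < 2 ^ (-α) := by
    have : (2:ℝ) ^ (-1:ℝ) < 2 ^ (-α) :=
      Real.rpow_lt_rpow_of_exponent_lt (by norm_num) (by linarith [hα.2])
    rw [Real.rpow_neg_one] at this
    linarith
  obtain ⟨X0, hX0⟩ := eventually_atTop.1 ((hreg 2 two_pos).eventually (lt_mem_nhds hc))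
  set X := max X0 1 with hXdef
  have hX1 : 1 ≤ X := le_max_right _ _
  have hX : ∀ s, X ≤ s → g s ≤ 2 * g (2 * s) := by
    intro s hs
    have h1 := hX0 s (le_trans (le_max_left _ _) hs)
    have hp := hpos s (by linarith)
    rw [lt_div_iff₀ hp] at h1
    linarith
  have hstep : ∀ a b, X ≤ a → a ≤ b → ∫ s in a..b, g s ≤ ∫ s in (2*a)..(2*b), g s := by
    intro a b ha hab
    have h1 : ∫ s in (2*a)..(2*b), g s = ∫ s in a..b, 2 * g (2 * s) := by
      rw [intervalIntegral.integral_const_mul]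
      exact (intervalIntegral.mul_integral_comp_mul_left (f := g) (2:ℝ)).symm
    rw [h1]
    refine intervalIntegral.integral_mono_on hab (hii a b (by linarith) (by linarith)) ?_
      (fun x hx => hX x (ha.trans hx.1))
    have h2 := (hii (2*a) (2*b) (by linarith) (by linarith)).comp_mul_left (c := 2)
    simpa using h2.const_mul 2
  set d := ∫ s in X..(2*X), g s with hd
  have hdpos : 0 < d := by
    refine intervalIntegral.intervalIntegral_pos_of_pos_on (hii _ _ (by linarith) (by linarith))
      (fun x hx => hpos x (by linarith [hx.1])) (by linarith)
  have hdn : ∀ n : ℕ, d ≤ ∫ s in (2^n*X)..(2^(n+1)*X), g s := by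
    intro n
    induction n with
    | zero => simp [hd]
    | succ n ih =>
      refine ih.trans ?_
      have h1 : (1:ℝ) ≤ 2^n := one_le_pow₀ (by norm_num)
      have := hstep (2^n*X) (2^(n+1)*X) (by nlinarith) (by rw [pow_succ]; nlinarith)
      have e1 : (2:ℝ) * (2^n*X) = 2^(n+1)*X := by ring
      have e2 : (2:ℝ) * (2^(n+1)*X) = 2^(n+1+1)*X := by ring
      rwa [e1, e2] at this
  have hGn : ∀ n : ℕ, n * d ≤ ∫ s in (0:ℝ)..(2^n*X), g s := by
    intro n
    induction n with
    | zero =>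
      simp only [Nat.cast_zero, zero_mul]
      refine intervalIntegral.integral_nonneg (by positivity) (fun u hu => (hpos u hu.1).le)
    | succ n ih =>
      rw [← intervalIntegral.integral_add_adjacent_intervals (b := 2^n*X)
        (hii _ _ le_rfl (by positivity)) (hii _ _ (by positivity) (by positivity))]
      have := hdn n
      push_cast
      linarith
  rw [tendsto_atTop]
  intro B
  obtain ⟨n, hn⟩ := exists_nat_gt (B / d)
  rw [div_lt_iff₀ hdpos] at hn
  filter_upwards [eventually_ge_atTop (2^n*X)] with t ht
  have h0 : 0 ≤ 2^n*X := by positivity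
  rw [← intervalIntegral.integral_add_adjacent_intervals (b := 2^n*X)
        (hii _ _ le_rfl h0) (hii _ _ h0 (h0.trans ht))]
  have h3 : 0 ≤ ∫ s in (2^n*X)..t, g s :=
    intervalIntegral.integral_nonneg ht (fun u hu => (hpos u (h0.trans hu.1)).le)
  linarith [hGn n]

lemma aux_main (g : ℝ → ℝ) (α : ℝ)
    (hpos : ∀ t : ℝ, 0 ≤ t → 0 < g t)
    (hii : ∀ a b : ℝ, 0 ≤ a → 0 ≤ b → IntervalIntegrable g volume a b)
    (hreg : ∀ l : ℝ, 0 < l →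
      Tendsto (fun t : ℝ => g (l * t) / g t) atTop (nhds (l ^ (-α))))
    (htop : Tendsto (fun t : ℝ => ∫ s in (0:ℝ)..t, g s) atTop atTop) (l : ℝ) (hl : 0 < l) :
    Tendsto (fun t : ℝ => (∫ s in (0:ℝ)..(l*t), g s) / (∫ s in (0:ℝ)..t, g s))
      atTop (nhds (l ^ (1 - α))) := by
  set c := l ^ (-α) with hc
  have hlc : l ^ (1 - α) = l * c := by
    rw [hc, sub_eq_add_neg, Real.rpow_add hl, Real.rpow_one]
  have hii2 : ∀ a b : ℝ, 0 ≤ a → 0 ≤ b → IntervalIntegrable (fun s => g (l * s)) volume a b := by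
    intro a b ha hb
    have h2 := (hii (l*a) (l*b) (by positivity) (by positivity)).comp_mul_left (c := l)
    simpa [hl.ne'] using h2
  have hiid : ∀ a b : ℝ, 0 ≤ a → 0 ≤ b →
      IntervalIntegrable (fun s => g (l * s) - c * g s) volume a b :=
    fun a b ha hb => (hii2 a b ha hb).sub ((hii a b ha hb).const_mul c)
  have key : Tendsto (fun t : ℝ => (∫ s in (0:ℝ)..t, (g (l * s) - c * g s)) /
      (∫ s in (0:ℝ)..t, g s)) atTop (nhds 0) := by
    rw [Metric.tendsto_atTop']
    intro ε hε
    obtain ⟨X0, hX0⟩ := Metric.tendsto_atTop.1 (hreg l hl) (ε/2) (by positivity)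
    set X := max X0 0
    have hXnn : 0 ≤ X := le_max_right _ _
    set K := |∫ s in (0:ℝ)..X, (g (l * s) - c * g s)|
    obtain ⟨T, hT⟩ := eventually_atTop.1 (htop.eventually_gt_atTop (2 * K / ε))
    refine ⟨max T X, fun t ht => ?_⟩
    have htT := hT t ((le_max_left _ _).trans ht.le)
    have htX : X ≤ t := (le_max_right _ _).trans ht.le
    have hGpos : 0 < ∫ s in (0:ℝ)..t, g s := lt_of_le_of_lt (by positivity) htT
    rw [dist_zero_right, Real.norm_eq_abs, abs_div, abs_of_pos hGpos, div_lt_iff₀ hGpos]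
    rw [← intervalIntegral.integral_add_adjacent_intervals (b := X)
        (hiid _ _ le_rfl hXnn) (hiid _ _ hXnn (hXnn.trans htX))]
    have h1 : |∫ s in X..t, (g (l * s) - c * g s)| ≤ ∫ s in X..t, ε/2 * g s := by
      refine intervalIntegral.norm_integral_le_of_norm_le (f := fun s => g (l * s) - c * g s)
        htX ?_
        ((hii _ _ hXnn (hXnn.trans htX)).const_mul _)
      refine Eventually.of_forall (fun s hs => ?_)
      have hp := hpos s (hXnn.trans hs.1.le)
      have h2 := hX0 s ((le_max_left _ _).trans hs.1.le)
      rw [Real.dist_eq] at h2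
      have h3 : g (l * s) - c * g s = (g (l*s) / g s - c) * g s := by
        field_simp
      rw [h3, norm_mul, Real.norm_eq_abs, Real.norm_eq_abs, abs_of_pos hp]
      exact mul_le_mul_of_nonneg_right h2.le hp.le
    rw [intervalIntegral.integral_const_mul] at h1
    have h4 : ∫ s in X..t, g s ≤ ∫ s in (0:ℝ)..t, g s := by
      rw [← intervalIntegral.integral_add_adjacent_intervals (b := X)
        (hii _ _ le_rfl hXnn) (hii _ _ hXnn (hXnn.trans htX))]
      have := intervalIntegral.integral_nonneg (μ := volume) hXnn (fun u hu => (hpos u hu.1).le)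
      linarith
    have h5 := abs_add_le (∫ s in (0:ℝ)..X, (g (l * s) - c * g s))
      (∫ s in X..t, (g (l * s) - c * g s))
    have h6 : ε/2 * ∫ s in X..t, g s ≤ ε/2 * ∫ s in (0:ℝ)..t, g s :=
      mul_le_mul_of_nonneg_left h4 (by positivity)
    rw [div_lt_iff₀ hε] at htT
    change _ ≤ K + _ at h5
    linarith
  have h := (key.add_const c).const_mul l
  rw [zero_add, ← hlc] at h
  refine h.congr' ?_
  filter_upwards [htop.eventually_gt_atTop 0, eventually_ge_atTop 0] with t ht ht0
  rw [intervalIntegral.integral_sub (hii2 _ _ le_rfl ht0) ((hii _ _ le_rfl ht0).const_mul c),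
    intervalIntegral.integral_const_mul]
  have h7 := intervalIntegral.mul_integral_comp_mul_left (f := g) (a := 0) (b := t) l
  rw [mul_zero] at h7
  rw [← h7]
  field_simp
  ring

/-- If `g : [1,∞) → (0,∞)` is bounded and regularly varying of exponent `α ∈ (0,1)`,
then `g̃(t) := ∫₀^⌊t⌋ g(s) ds` is regularly varying of exponent `-(1-α)`. -/
theorem stmt0 (g : ℝ → ℝ) (α : ℝ) (hα : α ∈ Set.Ioo (0:ℝ) 1)
    (hmeas : Measurable g)
    (hpos : ∀ t : ℝ, 0 ≤ t → 0 < g t)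
    (hbdd : ∃ M : ℝ, ∀ t : ℝ, g t ≤ M)
    (hreg : ∀ l : ℝ, 0 < l →
      Tendsto (fun t : ℝ => g (l * t) / g t) atTop (nhds (l ^ (-α)))) :
    ∀ l : ℝ, 0 < l →
      Tendsto (fun t : ℝ =>
          (∫ s in (0:ℝ)..((⌊l * t⌋ : ℤ) : ℝ), g s) / (∫ s in (0:ℝ)..((⌊t⌋ : ℤ) : ℝ), g s))
        atTop (nhds (l ^ (1 - α))) := by
  intro l hl
  obtain ⟨M, hM⟩ := hbdd
  have hii := aux_ii g hmeas hpos M hM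
  have htop := aux_top g α hα hpos hii hreg
  have hmain := aux_main g α hpos hii hreg htop l hl
  have hMpos : 0 < M := (hpos 0 le_rfl).trans_le (hM 0)
  have hr : ∀ x : ℝ, 0 ≤ x →
      |(∫ s in (0:ℝ)..((⌊x⌋ : ℤ) : ℝ), g s) - ∫ s in (0:ℝ)..x, g s| ≤ M := by
    intro x hx
    have hf : (0:ℝ) ≤ ((⌊x⌋ : ℤ) : ℝ) := by exact_mod_cast Int.floor_nonneg.2 hx
    have hfx := Int.floor_le x
    have hxf := Int.lt_floor_add_one x
    rw [intervalIntegral.integral_interval_sub_left (hii _ _ le_rfl hf) (hii _ _ le_rfl hx)]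
    have := intervalIntegral.norm_integral_le_of_norm_le_const (f := g) (C := M) (a := x)
      (b := ((⌊x⌋ : ℤ) : ℝ)) (fun s hs => by
        have h0 : 0 ≤ s := le_trans (le_min hx hf) hs.1.le
        rw [Real.norm_eq_abs, abs_of_pos (hpos s h0)]
        exact hM s)
    rw [Real.norm_eq_abs] at this
    refine this.trans ?_
    have h8 : |((⌊x⌋ : ℤ) : ℝ) - x| ≤ 1 := by rw [abs_le]; constructor <;> linarith
    nlinarith
  have hz : ∀ k : ℝ, 0 < k → Tendsto (fun t : ℝ =>
      ((∫ s in (0:ℝ)..((⌊k * t⌋ : ℤ) : ℝ), g s) - ∫ s in (0:ℝ)..(k * t), g s) /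
        ∫ s in (0:ℝ)..t, g s) atTop (nhds 0) := by
    intro k hk
    refine squeeze_zero_norm' ?_ (htop.const_div_atTop M)
    filter_upwards [htop.eventually_gt_atTop 0, eventually_ge_atTop 0] with t ht ht0
    rw [norm_div, Real.norm_eq_abs, Real.norm_eq_abs, abs_of_pos ht]
    exact div_le_div_of_nonneg_right (hr _ (by positivity)) ht.le
  have h1 := hmain.add (hz l hl)
  have h2 := (hz 1 one_pos).const_add 1
  have h3 := h1.div h2 (by norm_num)
  simp only [add_zero, div_one] at h3
  refine h3.congr' ?_
  filter_upwards [htop.eventually_gt_atTop 0] with t ht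
  simp only [one_mul, Pi.div_apply]
  have e1 : ∀ A B G : ℝ, 0 < G → B / G + (A - B) / G = A / G := by
    intro A B G _; ring
  have e2 : ∀ A G : ℝ, 0 < G → 1 + (A - G) / G = A / G := by
    intro A G hG; field_simp; ring
  rw [e1 _ _ _ ht, e2 _ _ ht, div_div_div_cancel_right₀ ht.ne']
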